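/- Let f(z) = Σ_{n=0}^∞ a_n z^n belong to the class B with |a₀| < 1, and let p > 0 and 0 < r < 1. Then Σ_{n=1}^∞ |a_n|² r^{pn} ≤ r^p (1 − |a₀|²)² / (1 − |a₀|² r^p). -/

import Mathlib

/-- Membership in the class `B` of analytic self-maps of the unit disk,
together with its Taylor coefficient sequence `a`. -/
def InClassB (f : ℂ → ℂ) (a : ℕ → ℂ) : Prop :=
  (∀ z : ℂ, ‖z‖ < 1 → HasSum (fun n => a n * z ^ n) (f z)) ∧
  (∀ z : ℂ, ‖z‖ < 1 → ‖f z‖ ≤ 1)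

open ComplexConjugate MeasureTheory

section Parseval

variable {c : ℕ → ℂ} {F : ℝ → ℂ}

lemma norm_exp_natCast_mul_I (n : ℕ) (θ : ℝ) : ‖Complex.exp (n * θ * Complex.I)‖ = 1 := by
  simpa using Complex.norm_exp_ofReal_mul_I (n * θ)

lemma integral_exp_natCast_mul_conj_exp (n m : ℕ) :
    ∫ θ in (0 : ℝ)..2 * Real.pi,
      Complex.exp (n * θ * Complex.I) * conj (Complex.exp (m * θ * Complex.I)) =
        if n = m then 2 * (Real.pi : ℂ) else 0 := by
  have key (θ : ℝ) :
      Complex.exp (n * θ * Complex.I) * conj (Complex.exp (m * θ * Complex.I)) =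
        Complex.exp ((((n : ℤ) - (m : ℤ) : ℤ) : ℂ) * Complex.I * θ) := by
    rw [← Complex.exp_conj, ← Complex.exp_add]
    congr 1
    simp
    ring
  simp_rw [key]
  split_ifs with h
  · simp [h]
  · have hz : (((n : ℤ) - (m : ℤ) : ℤ) : ℂ) ≠ 0 := by
      simp only [ne_eq, Int.cast_eq_zero]
      omega
    rw [integral_exp_mul_complex (mul_ne_zero hz Complex.I_ne_zero)]
    have := Complex.exp_int_mul_two_pi_mul_I ((n : ℤ) - (m : ℤ))
    rw [show (((n : ℤ) - (m : ℤ) : ℤ) : ℂ) * Complex.I * ((2 * Real.pi : ℝ) : ℂ) =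
      (((n : ℤ) - (m : ℤ) : ℤ) : ℂ) * (2 * Real.pi * Complex.I) by push_cast; ring, this]
    simp

lemma continuous_of_hasSum_exp (hc : Summable fun n => ‖c n‖)
    (hF : ∀ θ : ℝ, HasSum (fun n => c n * Complex.exp (n * θ * Complex.I)) (F θ)) :
    Continuous F := by
  have : F = fun θ : ℝ => ∑' n : ℕ, c n * Complex.exp (n * θ * Complex.I) :=
    funext fun θ => (hF θ).tsum_eq.symm
  rw [this]
  refine continuous_tsum (fun n => by fun_prop) hc fun n θ => ?_
  rw [norm_mul, norm_exp_natCast_mul_I, mul_one]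

lemma hasSum_integral_exp_mul (hc : Summable fun n => ‖c n‖)
    (hF : ∀ θ : ℝ, HasSum (fun n => c n * Complex.exp (n * θ * Complex.I)) (F θ))
    {G : ℝ → ℂ} (hG : Continuous G) (s t : ℝ) :
    HasSum (fun n : ℕ => c n * ∫ θ in s..t, Complex.exp (n * θ * Complex.I) * G θ)
      (∫ θ in s..t, F θ * G θ) := by
  simp_rw [← intervalIntegral.integral_const_mul, ← mul_assoc]
  refine intervalIntegral.hasSum_integral_of_dominated_convergence
    (fun n θ => ‖c n‖ * ‖G θ‖) (fun n => ?_) (fun n => ?_) ?_ ?_ ?_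
  · exact Continuous.aestronglyMeasurable (by fun_prop)
  · refine .of_forall fun θ _ => ?_
    rw [norm_mul, norm_mul, norm_exp_natCast_mul_I, mul_one]
  · exact .of_forall fun θ _ => hc.mul_right _
  · simp_rw [tsum_mul_right]
    exact Continuous.intervalIntegrable (by fun_prop) _ _
  · exact .of_forall fun θ _ => (hF θ).mul_right _

/-- **Parseval's identity** for absolutely convergent one-sided Fourier series. -/
lemma hasSum_sq_norm_of_hasSum_exp (hc : Summable fun n => ‖c n‖)
    (hF : ∀ θ : ℝ, HasSum (fun n => c n * Complex.exp (n * θ * Complex.I)) (F θ)) :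
    HasSum (fun n => 2 * Real.pi * ‖c n‖ ^ 2) (∫ θ in (0 : ℝ)..2 * Real.pi, ‖F θ‖ ^ 2) := by
  have hFc := continuous_of_hasSum_exp hc hF
  have coeff (m : ℕ) :
      ∫ θ in (0 : ℝ)..2 * Real.pi, F θ * conj (Complex.exp (m * θ * Complex.I)) =
        2 * Real.pi * c m := by
    have h := hasSum_integral_exp_mul hc hF
      (G := fun θ => conj (Complex.exp (m * θ * Complex.I)))
      (Complex.continuous_conj.comp (by fun_prop)) 0 (2 * Real.pi)
    simp_rw [integral_exp_natCast_mul_conj_exp] at h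
    refine h.unique ?_
    convert hasSum_ite_eq m (2 * (Real.pi : ℂ) * c m) using 2 with n
    split_ifs with hnm
    · rw [hnm, mul_comm]
    · simp
  have h := hasSum_integral_exp_mul hc hF (G := fun θ => conj (F θ))
    (Complex.continuous_conj.comp hFc) 0 (2 * Real.pi)
  have conj_coeff (n : ℕ) :
      ∫ θ in (0 : ℝ)..2 * Real.pi, Complex.exp (n * θ * Complex.I) * conj (F θ) =
        2 * Real.pi * conj (c n) := by
    have := congrArg conj (coeff n)
    rw [intervalIntegral.integral_of_le (by positivity), ← integral_conj,
      ← intervalIntegral.integral_of_le (by positivity)] at this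
    simpa only [map_mul, map_ofNat, Complex.conj_ofReal, Complex.conj_conj,
      mul_comm (conj (F _))] using this
  simp_rw [conj_coeff, Complex.mul_conj, Complex.normSq_eq_norm_sq] at h
  rw [intervalIntegral.integral_ofReal] at h
  rw [← Complex.hasSum_ofReal]
  convert h using 2 with n
  push_cast
  rw [← Complex.mul_conj']
  ring

end Parseval

section SchwarzPick

lemma one_sub_conj_mul_ne_zero {a w : ℂ} (ha : ‖a‖ < 1) (hw : ‖w‖ ≤ 1) :
    1 - conj a * w ≠ 0 := by
  intro h
  have h1 : ‖conj a * w‖ = 1 := by rw [← sub_eq_zero.mp h, norm_one]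
  rw [norm_mul, RCLike.norm_conj] at h1
  nlinarith [norm_nonneg a, norm_nonneg w]

lemma norm_sub_le_norm_one_sub_conj_mul {a w : ℂ} (ha : ‖a‖ ≤ 1) (hw : ‖w‖ ≤ 1) :
    ‖w - a‖ ≤ ‖1 - conj a * w‖ := by
  have h : ‖1 - conj a * w‖ ^ 2 - ‖w - a‖ ^ 2 = (1 - ‖a‖ ^ 2) * (1 - ‖w‖ ^ 2) := by
    simp only [← Complex.normSq_eq_norm_sq, Complex.normSq_apply, Complex.sub_re, Complex.sub_im,
      Complex.mul_re, Complex.mul_im, Complex.conj_re, Complex.conj_im, Complex.one_re,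
      Complex.one_im]
    ring
  refine le_of_sq_le_sq ?_ (norm_nonneg _)
  nlinarith [mul_nonneg (sub_nonneg.2 (pow_le_one₀ (n := 2) (norm_nonneg a) ha))
    (sub_nonneg.2 (pow_le_one₀ (n := 2) (norm_nonneg w) hw))]

/-- The **Schwarz–Pick inequality** at the origin, in product form. -/
lemma norm_sub_le_mul_norm_one_sub_conj_mul {f : ℂ → ℂ}
    (hd : DifferentiableOn ℂ f (Metric.ball 0 1)) (hb : ∀ z : ℂ, ‖z‖ < 1 → ‖f z‖ ≤ 1)
    (h0 : ‖f 0‖ < 1) {z : ℂ} (hz : ‖z‖ < 1) :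
    ‖f z - f 0‖ ≤ ‖z‖ * ‖1 - conj (f 0) * f z‖ := by
  have hne (w : ℂ) (hw : ‖w‖ < 1) := one_sub_conj_mul_ne_zero h0 (hb w hw)
  have h := Complex.norm_le_norm_of_mapsTo_ball (R := 1) (z := z)
    (f := fun w => (f w - f 0) / (1 - conj (f 0) * f w))
    ((hd.sub_const _).div ((hd.const_mul _).const_sub _)
      fun w hw => hne w (mem_ball_zero_iff.1 hw))
    (fun w hw => by
      rw [mem_ball_zero_iff] at hw
      rw [mem_closedBall_zero_iff, norm_div, div_le_one (norm_pos_iff.2 (hne w hw))]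
      exact norm_sub_le_norm_one_sub_conj_mul h0.le (hb w hw))
    (by simp) hz
  rwa [norm_div, div_le_iff₀ (norm_pos_iff.2 (hne z hz))] at h

end SchwarzPick

namespace InClassB

variable {f : ℂ → ℂ} {a : ℕ → ℂ}

lemma apply_zero (hf : InClassB f a) : f 0 = a 0 := by
  refine (hf.1 0 (by simp)).unique ?_
  convert hasSum_single (f := fun n => a n * (0 : ℂ) ^ n) 0 fun n hn => by simp [hn] using 1
  simp

lemma summable_norm_mul_pow (hf : InClassB f a) {R : ℝ} (hR0 : 0 ≤ R) (hR1 : R < 1) :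
    Summable fun n => ‖a n * (R : ℂ) ^ n‖ :=
  (hf.1 R (by rwa [Complex.norm_real, Real.norm_of_nonneg hR0])).summable.norm

lemma differentiableOn (hf : InClassB f a) : DifferentiableOn ℂ f (Metric.ball 0 1) := by
  intro z hz
  rw [mem_ball_zero_iff] at hz
  obtain ⟨s, hzs, hs1⟩ := exists_between hz
  have hs0 : 0 ≤ s := (norm_nonneg z).trans hzs.le
  have hd : DifferentiableOn ℂ (fun w => ∑' n, a n * w ^ n) (Metric.ball 0 s) := by
    refine Complex.differentiableOn_tsum_of_summable_norm (hf.summable_norm_mul_pow hs0 hs1)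
      (fun n => by fun_prop) Metric.isOpen_ball fun n w hw => ?_
    rw [mem_ball_zero_iff] at hw
    rw [norm_mul, norm_mul, norm_pow, norm_pow, Complex.norm_real, Real.norm_of_nonneg hs0]
    gcongr
  have hd' : DifferentiableOn ℂ f (Metric.ball 0 s) :=
    hd.congr fun w hw => (hf.1 w ((mem_ball_zero_iff.1 hw).trans hs1)).tsum_eq.symm
  exact (hd'.differentiableAt
    (Metric.isOpen_ball.mem_nhds (mem_ball_zero_iff.2 hzs))).differentiableWithinAt

lemma tsum_sq_norm_mul_pow_le (hf : InClassB f a) (ha0 : ‖a 0‖ < 1) {R : ℝ} (hR0 : 0 ≤ R)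
    (hR1 : R < 1) :
    ∑' n : ℕ, ‖a (n + 1)‖ ^ 2 * (R ^ 2) ^ (n + 1) ≤
      R ^ 2 * (1 - ‖a 0‖ ^ 2) ^ 2 / (1 - ‖a 0‖ ^ 2 * R ^ 2) := by
  set z : ℝ → ℂ := fun θ => R * Complex.exp (θ * Complex.I) with hz
  have hzn (θ : ℝ) : ‖z θ‖ = R := by simp [hz, Complex.norm_exp_ofReal_mul_I, abs_of_nonneg hR0]
  have hz1 (θ : ℝ) : ‖z θ‖ < 1 := (hzn θ).trans_lt hR1
  set c : ℕ → ℂ := fun n => a n * (R : ℂ) ^ n with hc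
  have hcs : Summable fun n => ‖c n‖ := hf.summable_norm_mul_pow hR0 hR1
  have hcF (θ : ℝ) : HasSum (fun n => c n * Complex.exp (n * θ * Complex.I)) (f (z θ)) := by
    convert hf.1 (z θ) (hz1 θ) using 2 with n
    simp only [hz, hc, mul_pow, ← Complex.exp_nat_mul, mul_assoc]
  have hsingle (x : ℂ) (θ : ℝ) : HasSum
      (fun n : ℕ => (Pi.single 0 x : ℕ → ℂ) n * Complex.exp (n * θ * Complex.I)) x := by
    convert hasSum_single (f := fun n : ℕ =>
      (Pi.single 0 x : ℕ → ℂ) n * Complex.exp (n * θ * Complex.I)) 0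
      fun n hn => by simp [hn] using 1
    simp
  have hsingle_s (x : ℂ) : Summable fun n : ℕ => (Pi.single 0 x : ℕ → ℂ) n :=
    (hasSum_pi_single 0 x).summable
  set b : ℕ → ℂ := fun n => c n - (Pi.single 0 (a 0) : ℕ → ℂ) n with hb
  set d : ℕ → ℂ := fun n => (Pi.single 0 1 : ℕ → ℂ) n - conj (a 0) * c n with hd
  have hbs : Summable fun n => ‖b n‖ := (hcs.of_norm.sub (hsingle_s _)).norm
  have hds : Summable fun n => ‖d n‖ := ((hsingle_s _).sub (hcs.of_norm.mul_left _)).norm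
  have hbF (θ : ℝ) :
      HasSum (fun n => b n * Complex.exp (n * θ * Complex.I)) (f (z θ) - a 0) := by
    simpa only [hb, sub_mul] using (hcF θ).sub (hsingle _ θ)
  have hdF (θ : ℝ) :
      HasSum (fun n => d n * Complex.exp (n * θ * Complex.I)) (1 - conj (a 0) * f (z θ)) := by
    simpa only [hd, sub_mul, mul_assoc] using (hsingle 1 θ).sub ((hcF θ).mul_left _)
  have hbP := hasSum_sq_norm_of_hasSum_exp hbs hbF
  have hdP := hasSum_sq_norm_of_hasSum_exp hds hdF
  have hbc := continuous_of_hasSum_exp hbs hbF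
  have hdc := continuous_of_hasSum_exp hds hdF
  have hint : ∫ θ in (0 : ℝ)..2 * Real.pi, ‖f (z θ) - a 0‖ ^ 2 ≤
      R ^ 2 * ∫ θ in (0 : ℝ)..2 * Real.pi, ‖1 - conj (a 0) * f (z θ)‖ ^ 2 := by
    rw [← intervalIntegral.integral_const_mul]
    refine intervalIntegral.integral_mono_on (by positivity)
      (Continuous.intervalIntegrable (by fun_prop) _ _)
      (Continuous.intervalIntegrable (by fun_prop) _ _) fun θ _ => ?_
    have h := norm_sub_le_mul_norm_one_sub_conj_mul hf.differentiableOn hf.2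
      (hf.apply_zero.symm ▸ ha0) (hz1 θ)
    rw [hf.apply_zero, hzn] at h
    rw [← mul_pow]
    gcongr
  set S := ∑' n : ℕ, ‖a (n + 1)‖ ^ 2 * (R ^ 2) ^ (n + 1) with hS
  have hbn (n : ℕ) :
      2 * Real.pi * ‖b (n + 1)‖ ^ 2 = 2 * Real.pi * (‖a (n + 1)‖ ^ 2 * (R ^ 2) ^ (n + 1)) := by
    simp only [hb, hc, Pi.single_apply, n.succ_ne_zero, if_false, sub_zero, norm_mul, norm_pow,
      Complex.norm_real, Real.norm_of_nonneg hR0]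
    ring
  have hdn (n : ℕ) : 2 * Real.pi * ‖d (n + 1)‖ ^ 2 =
      2 * Real.pi * ‖a 0‖ ^ 2 * (‖a (n + 1)‖ ^ 2 * (R ^ 2) ^ (n + 1)) := by
    simp only [hd, hc, Pi.single_apply, n.succ_ne_zero, if_false, zero_sub, norm_neg, norm_mul,
      RCLike.norm_conj, norm_pow, Complex.norm_real, Real.norm_of_nonneg hR0]
    ring
  have hb0 : b 0 = 0 := by simp [hb, hc]
  have hd0 : ‖d 0‖ ^ 2 = (1 - ‖a 0‖ ^ 2) ^ 2 := by
    have : d 0 = ((1 - ‖a 0‖ ^ 2 : ℝ) : ℂ) := by simp [hd, hc, Complex.conj_mul']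
    rw [this, Complex.norm_real, Real.norm_eq_abs, sq_abs]
  rw [← hbP.tsum_eq, ← hdP.tsum_eq, hbP.summable.tsum_eq_zero_add,
    hdP.summable.tsum_eq_zero_add, hb0, hd0] at hint
  simp_rw [hbn, hdn, tsum_mul_left, ← hS] at hint
  have hpi := Real.pi_pos
  have hle : S ≤ R ^ 2 * ((1 - ‖a 0‖ ^ 2) ^ 2 + ‖a 0‖ ^ 2 * S) := by
    refine le_of_mul_le_mul_left ?_ (show 0 < 2 * Real.pi by positivity)
    simp only [norm_zero] at hint
    linarith
  have hden : 0 < 1 - ‖a 0‖ ^ 2 * R ^ 2 := by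
    rw [← mul_pow, sub_pos]
    exact pow_lt_one₀ (by positivity)
      (mul_lt_one_of_nonneg_of_lt_one_left (norm_nonneg _) ha0 hR1.le) two_ne_zero
  rw [le_div_iff₀ hden]
  linarith

end InClassB

theorem stmt_15 (f : ℂ → ℂ) (a : ℕ → ℂ) (hf : InClassB f a) (ha0 : ‖a 0‖ < 1)
    (p : ℝ) (hp : 0 < p) (r : ℝ) (hr0 : 0 < r) (hr1 : r < 1) :
    ∑' n : ℕ, ‖a (n + 1)‖ ^ 2 * r ^ (p * ((n : ℝ) + 1))
      ≤ r ^ p * (1 - ‖a 0‖ ^ 2) ^ 2 / (1 - ‖a 0‖ ^ 2 * r ^ p) := by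
  have hρ0 : 0 ≤ r ^ p := Real.rpow_nonneg hr0.le p
  have hρ1 : r ^ p < 1 := Real.rpow_lt_one hr0.le hr1 hp
  have h := hf.tsum_sq_norm_mul_pow_le ha0 (Real.sqrt_nonneg (r ^ p))
    ((Real.sqrt_lt' one_pos).2 (by simpa using hρ1))
  rw [Real.sq_sqrt hρ0] at h
  convert h using 4 with n
  rw [Real.rpow_mul hr0.le, ← Real.rpow_natCast]
  push_cast
  rfl
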